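/- In the balanced product X↕ ×_G X↔ of two bipartite graphs with free G-invariant actions, for any vertices z00 ∈ V00, z10 ∈ V10, z01 ∈ V01 with (z00, z10) ∈ E•0 and (z00, z01) ∈ E0•, there exists a unique vertex z11 ∈ V11 such that (z00, z10, z01, z11) ∈ F. -/

import Mathlib

open scoped Classical

noncomputable section

/-- Vertex set of the balanced product: orbits of the diagonal `G`-action on `A × B`. -/
abbrev BPV (G : Type*) [Group G] (A B : Type*) [MulAction G A] [MulAction G B] :=
  Quotient (MulAction.orbitRel G (A × B))

/-- The orbit `[(a, b)]` as a balanced-product vertex. -/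
def bpmk (G : Type*) [Group G] {A B : Type*} [MulAction G A] [MulAction G B]
    (a : A) (b : B) : BPV G A B :=
  Quotient.mk (MulAction.orbitRel G (A × B)) (a, b)

/-- Vertical edges of the balanced product: pairs `([x0, y], [x1, y])` with `(x0, x1)`
an edge of the first factor. -/
def EV (G : Type*) [Group G] {A0 A1 B : Type*}
    [MulAction G A0] [MulAction G A1] [MulAction G B]
    (Eud : A0 → A1 → Prop) (z0 : BPV G A0 B) (z1 : BPV G A1 B) : Prop :=
  ∃ (x0 : A0) (x1 : A1) (y : B), Eud x0 x1 ∧ z0 = bpmk G x0 y ∧ z1 = bpmk G x1 y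

/-- Horizontal edges of the balanced product: pairs `([x, y0], [x, y1])` with `(y0, y1)`
an edge of the second factor. -/
def EH (G : Type*) [Group G] {A B0 B1 : Type*}
    [MulAction G A] [MulAction G B0] [MulAction G B1]
    (Elr : B0 → B1 → Prop) (z0 : BPV G A B0) (z1 : BPV G A B1) : Prop :=
  ∃ (x : A) (y0 : B0) (y1 : B1), Elr y0 y1 ∧ z0 = bpmk G x y0 ∧ z1 = bpmk G x y1

/-- Faces of the balanced product: quadruples `([x0,y0], [x1,y0], [x0,y1], [x1,y1])` with
`(x0, x1)` an edge of the first factor and `(y0, y1)` an edge of the second factor. -/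
def Face (G : Type*) [Group G] {A0 A1 B0 B1 : Type*}
    [MulAction G A0] [MulAction G A1] [MulAction G B0] [MulAction G B1]
    (Eud : A0 → A1 → Prop) (Elr : B0 → B1 → Prop)
    (z00 : BPV G A0 B0) (z10 : BPV G A1 B0) (z01 : BPV G A0 B1) (z11 : BPV G A1 B1) : Prop :=
  ∃ (x0 : A0) (x1 : A1) (y0 : B0) (y1 : B1), Eud x0 x1 ∧ Elr y0 y1 ∧
    z00 = bpmk G x0 y0 ∧ z10 = bpmk G x1 y0 ∧ z01 = bpmk G x0 y1 ∧ z11 = bpmk G x1 y1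

theorem bpmk_eq_bpmk_iff {G A B : Type*} [Group G] [MulAction G A] [MulAction G B]
    {a a' : A} {b b' : B} :
    bpmk G a b = bpmk G a' b' ↔ ∃ g : G, g • a' = a ∧ g • b' = b := by
  unfold bpmk
  rw [Quotient.eq, MulAction.orbitRel_apply, MulAction.mem_orbit_iff]
  simp only [Prod.smul_mk, Prod.mk.injEq]

theorem bpmk_smul_smul {G A B : Type*} [Group G] [MulAction G A] [MulAction G B]
    (g : G) (a : A) (b : B) : bpmk G (g • a) (g • b) = bpmk G a b :=
  bpmk_eq_bpmk_iff.2 ⟨g, rfl, rfl⟩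

/-- If `G` acts freely on `B`, then `a ↦ [(a, b)]` is injective. -/
theorem bpmk_left_injective {G A B : Type*} [Group G] [MulAction G A] [MulAction G B]
    (hfree : ∀ (g : G) (b : B), g • b = b → g = 1) {a a' : A} {b : B}
    (h : bpmk G a b = bpmk G a' b) : a = a' := by
  obtain ⟨g, ha, hb⟩ := bpmk_eq_bpmk_iff.1 h
  rw [← ha, hfree g b hb, one_smul]

/-- If `G` acts freely on `A`, then `b ↦ [(a, b)]` is injective. -/
theorem bpmk_right_injective {G A B : Type*} [Group G] [MulAction G A] [MulAction G B]
    (hfree : ∀ (g : G) (a : A), g • a = a → g = 1) {a : A} {b b' : B}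
    (h : bpmk G a b = bpmk G a b') : b = b' := by
  obtain ⟨g, ha, hb⟩ := bpmk_eq_bpmk_iff.1 h
  rw [← hb, hfree g a ha, one_smul]

/-- **Square completion lemma.** In the balanced product of two bipartite graphs with free
`G`-invariant actions, any `z00 ∈ V00`, `z10 ∈ V10`, `z01 ∈ V01` with `(z00, z10) ∈ E•0` and
`(z00, z01) ∈ E0•` complete to a unique square `(z00, z10, z01, z11) ∈ F`. -/
theorem square_completion
    {G V0a V1a Vb0 Vb1 : Type*} [Group G]
    [MulAction G V0a] [MulAction G V1a] [MulAction G Vb0] [MulAction G Vb1]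
    (Eud : V0a → V1a → Prop) (Elr : Vb0 → Vb1 → Prop)
    (hfree0a : ∀ (g : G) (x : V0a), g • x = x → g = 1)
    (hfree1a : ∀ (g : G) (x : V1a), g • x = x → g = 1)
    (hfreeb0 : ∀ (g : G) (y : Vb0), g • y = y → g = 1)
    (hfreeb1 : ∀ (g : G) (y : Vb1), g • y = y → g = 1)
    (hinvud : ∀ (g : G) (x0 : V0a) (x1 : V1a), Eud x0 x1 → Eud (g • x0) (g • x1))
    (hinvlr : ∀ (g : G) (y0 : Vb0) (y1 : Vb1), Elr y0 y1 → Elr (g • y0) (g • y1))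
    (z00 : BPV G V0a Vb0) (z10 : BPV G V1a Vb0) (z01 : BPV G V0a Vb1)
    (h10 : EV G Eud z00 z10) (h01 : EH G Elr z00 z01) :
    ∃! z11 : BPV G V1a Vb1, Face G Eud Elr z00 z10 z01 z11 := by
  obtain ⟨x0, x1, y0, hx, rfl, rfl⟩ := h10
  obtain ⟨x0', y0', y1, hy, h00, rfl⟩ := h01
  obtain ⟨g, rfl, rfl⟩ := bpmk_eq_bpmk_iff.1 h00
  refine ⟨bpmk G x1 (g • y1), ⟨g • x0', x1, g • y0', g • y1, hx, hinvlr g _ _ hy, rfl, rfl,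
    (bpmk_smul_smul g x0' y1).symm, rfl⟩, ?_⟩
  rintro _ ⟨u0, u1, v0, v1, -, -, h, h10, h01, rfl⟩
  obtain ⟨k, hu, hv⟩ := bpmk_eq_bpmk_iff.1 h
  rw [← bpmk_smul_smul k u1, hv] at h10
  rw [← bpmk_smul_smul g, ← bpmk_smul_smul k u0, hu] at h01
  rw [← bpmk_smul_smul k u1, bpmk_left_injective hfreeb0 h10, bpmk_right_injective hfree0a h01]
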